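/- Theorem 3 (sufficiency): If l₁ > n − d, then from every admissible initial state there exists a time t₀ such that the system is in collapse from time t₀. -/

import Mathlib

open Filter

/-! Two-contour Buslaev system with co-directional movement.
Parameters: `n` cells per contour, node 1 between cells `n-1` and `0`,
node 2 between cells `d-1` and `d`; cluster `i` has `lᵢ` particles. -/

/-- A state records the leading cells of clusters 1 and 2. -/
abbrev TCState (n : ℕ) := ZMod n × ZMod n

/-- Cluster with leading cell `x` is at node 1 (i.e. in cell `n-1`). -/
def AtNode1 (n : ℕ) (x : ZMod n) : Prop := x = (-1 : ZMod n)

/-- Cluster with leading cell `x` is at node 2 (i.e. in cell `d-1`). -/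
def AtNode2 (n d : ℕ) (x : ZMod n) : Prop := x = (d : ZMod n) - 1

/-- A cluster of length `l` with leading cell `x` occupies node 1:
`x ∈ {0, 1, …, l-2}` (mod `n`). -/
def OccupiesNode1 (n l : ℕ) (x : ZMod n) : Prop :=
  ∃ k : ℕ, k + 2 ≤ l ∧ x = (k : ZMod n)

/-- A cluster of length `l` with leading cell `x` occupies node 2:
`x ∈ {d, d+1, …, d+l-2}` (mod `n`). -/
def OccupiesNode2 (n d l : ℕ) (x : ZMod n) : Prop :=
  ∃ k : ℕ, k + 2 ≤ l ∧ x = ((d + k : ℕ) : ZMod n)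

/-- Cluster 1 advances from state `x` unless it is at a node occupied by cluster 2. -/
def Moves1 (n d l₂ : ℕ) (x : TCState n) : Prop :=
  ¬ ((AtNode1 n x.1 ∧ OccupiesNode1 n l₂ x.2) ∨
     (AtNode2 n d x.1 ∧ OccupiesNode2 n d l₂ x.2))

/-- Cluster 2 advances from state `x` unless it is at a node occupied by cluster 1,
or both clusters are at the same node (in which case cluster 1 has priority). -/
def Moves2 (n d l₁ : ℕ) (x : TCState n) : Prop :=
  ¬ ((AtNode1 n x.2 ∧ OccupiesNode1 n l₁ x.1) ∨
     (AtNode2 n d x.2 ∧ OccupiesNode2 n d l₁ x.1) ∨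
     (AtNode1 n x.1 ∧ AtNode1 n x.2) ∨
     (AtNode2 n d x.1 ∧ AtNode2 n d x.2))

open Classical in
/-- One step of the dynamics. -/
noncomputable def tcStep (n d l₁ l₂ : ℕ) (x : TCState n) : TCState n :=
  (if Moves1 n d l₂ x then x.1 + 1 else x.1,
   if Moves2 n d l₁ x then x.2 + 1 else x.2)

/-- A state is admissible if no node is occupied by both clusters. -/
def Admissible (n d l₁ l₂ : ℕ) (x : TCState n) : Prop :=
  ¬ (OccupiesNode1 n l₁ x.1 ∧ OccupiesNode1 n l₂ x.2) ∧
  ¬ (OccupiesNode2 n d l₁ x.1 ∧ OccupiesNode2 n d l₂ x.2)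

/-- `traj n d l₁ l₂ x0 t` is the state `x(t)` starting from `x(0) = x0`. -/
noncomputable def traj (n d l₁ l₂ : ℕ) (x0 : TCState n) (t : ℕ) : TCState n :=
  (tcStep n d l₁ l₂)^[t] x0

/-- Free movement from time `t₀`: both clusters advance at every step `t ≥ t₀`. -/
def FreeFrom (n d l₁ l₂ : ℕ) (x0 : TCState n) (t₀ : ℕ) : Prop :=
  ∀ t, t₀ ≤ t →
    Moves1 n d l₂ (traj n d l₁ l₂ x0 t) ∧ Moves2 n d l₁ (traj n d l₁ l₂ x0 t)

/-- Collapse from time `t₀`: neither cluster advances at any step `t ≥ t₀`. -/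
def CollapseFrom (n d l₁ l₂ : ℕ) (x0 : TCState n) (t₀ : ℕ) : Prop :=
  ∀ t, t₀ ≤ t →
    ¬ Moves1 n d l₂ (traj n d l₁ l₂ x0 t) ∧ ¬ Moves2 n d l₁ (traj n d l₁ l₂ x0 t)

open Classical in
/-- `H1`: the number of steps `s < t` at which cluster 1 advances. -/
noncomputable def H1 (n d l₁ l₂ : ℕ) (x0 : TCState n) (t : ℕ) : ℕ :=
  ((Finset.range t).filter (fun s => Moves1 n d l₂ (traj n d l₁ l₂ x0 s))).card

open Classical in
/-- `H2`: the number of steps `s < t` at which cluster 2 advances. -/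
noncomputable def H2 (n d l₁ l₂ : ℕ) (x0 : TCState n) (t : ℕ) : ℕ :=
  ((Finset.range t).filter (fun s => Moves2 n d l₁ (traj n d l₁ l₂ x0 s))).card

theorem natCast_zmod_eq_iff {n a b : ℕ} (ha : a < n) (hb : b < n) :
    (a : ZMod n) = (b : ZMod n) ↔ a = b := by
  rw [ZMod.natCast_eq_natCast_iff', Nat.mod_eq_of_lt ha, Nat.mod_eq_of_lt hb]

theorem atNode1_natCast_iff {n a : ℕ} (ha : a < n) :
    AtNode1 n (a : ZMod n) ↔ a = n - 1 := by
  have hn : 1 ≤ n := by omega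
  have h : (-1 : ZMod n) = ((n - 1 : ℕ) : ZMod n) := by simp [Nat.cast_sub hn]
  rw [AtNode1, h, natCast_zmod_eq_iff ha (by omega)]

theorem atNode2_natCast_iff {n d a : ℕ} (hd : 0 < d) (hdn : d ≤ n) (ha : a < n) :
    AtNode2 n d (a : ZMod n) ↔ a = d - 1 := by
  have h : (d : ZMod n) - 1 = ((d - 1 : ℕ) : ZMod n) := by
    simp [Nat.cast_sub (Nat.succ_le_of_lt hd)]
  rw [AtNode2, h, natCast_zmod_eq_iff ha (by omega)]

/-- A cluster longer than `n - d` whose leading cell lies in `{0, …, d-1}` occupies node 1. -/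
theorem occupiesNode1_natCast {n d l a : ℕ} (hdn : 2 * d ≤ n) (hl : n - d < l) (ha : a < d) :
    OccupiesNode1 n l (a : ZMod n) :=
  ⟨a, by omega, rfl⟩

/-- A cluster longer than `n - d` whose leading cell lies in `{d, …, n-1}` occupies node 2. -/
theorem occupiesNode2_natCast {n d l b : ℕ} (hl : n - d < l) (hdb : d ≤ b) (hb : b < n) :
    OccupiesNode2 n d l (b : ZMod n) :=
  ⟨b - d, by omega, by rw [Nat.add_sub_cancel' hdb]⟩

section Opposite

variable {n d l a b : ℕ}

theorem moves1_low_high_iff (hd : 0 < d) (hdn : 2 * d ≤ n) (hl : n - d < l)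
    (ha : a < d) (hdb : d ≤ b) (hb : b < n) :
    Moves1 n d l ((a : ZMod n), (b : ZMod n)) ↔ a ≠ d - 1 := by
  have h2 := occupiesNode2_natCast hl hdb hb
  have hne : a ≠ n - 1 := by omega
  simp [Moves1, atNode1_natCast_iff (show a < n by omega),
    atNode2_natCast_iff hd (show d ≤ n by omega) (show a < n by omega), h2, hne]

theorem moves2_low_high_iff (hd : 0 < d) (hdn : 2 * d ≤ n) (hl : n - d < l)
    (ha : a < d) (hdb : d ≤ b) (hb : b < n) :
    Moves2 n d l ((a : ZMod n), (b : ZMod n)) ↔ b ≠ n - 1 := by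
  have h1 := occupiesNode1_natCast hdn hl ha
  have hne : a ≠ n - 1 := by omega
  have hne' : b ≠ d - 1 := by omega
  simp [Moves2, atNode1_natCast_iff (show a < n by omega), atNode1_natCast_iff hb,
    atNode2_natCast_iff hd (show d ≤ n by omega) (show a < n by omega),
    atNode2_natCast_iff hd (show d ≤ n by omega) hb, h1, hne, hne']

theorem moves1_high_low_iff (hd : 0 < d) (hdn : 2 * d ≤ n) (hl : n - d < l)
    (ha : a < d) (hdb : d ≤ b) (hb : b < n) :
    Moves1 n d l ((b : ZMod n), (a : ZMod n)) ↔ b ≠ n - 1 := by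
  have h1 := occupiesNode1_natCast hdn hl ha
  have hne : b ≠ d - 1 := by omega
  simp [Moves1, atNode1_natCast_iff hb,
    atNode2_natCast_iff hd (show d ≤ n by omega) hb, h1, hne]

theorem moves2_high_low_iff (hd : 0 < d) (hdn : 2 * d ≤ n) (hl : n - d < l)
    (ha : a < d) (hdb : d ≤ b) (hb : b < n) :
    Moves2 n d l ((b : ZMod n), (a : ZMod n)) ↔ a ≠ d - 1 := by
  have h2 := occupiesNode2_natCast hl hdb hb
  have hne : a ≠ n - 1 := by omega
  have hne' : b ≠ d - 1 := by omega
  simp [Moves2, atNode1_natCast_iff (show a < n by omega), atNode1_natCast_iff hb,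
    atNode2_natCast_iff hd (show d ≤ n by omega) (show a < n by omega),
    atNode2_natCast_iff hd (show d ≤ n by omega) hb, h2, hne, hne']

end Opposite

open Classical in
/-- A leading cell that advances until it reaches cell `m` is at `min (a + t) m` at time `t`. -/
theorem ite_natCast_min_succ {n a m t : ℕ} {p : Prop} (hp : p ↔ min (a + t) m ≠ m) :
    (if p then ((min (a + t) m : ℕ) : ZMod n) + 1 else ((min (a + t) m : ℕ) : ZMod n)) =
      ((min (a + (t + 1)) m : ℕ) : ZMod n) := by
  split_ifs with h
  · rw [hp] at h
    rw [show min (a + (t + 1)) m = min (a + t) m + 1 by omega, Nat.cast_succ]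
  · rw [hp] at h
    rw [show min (a + (t + 1)) m = min (a + t) m by omega]

theorem traj_succ (n d l₁ l₂ : ℕ) (x0 : TCState n) (t : ℕ) :
    traj n d l₁ l₂ x0 (t + 1) = tcStep n d l₁ l₂ (traj n d l₁ l₂ x0 t) :=
  Function.iterate_succ_apply' _ _ _

section LongClusters

variable {n d l₁ l₂ a b : ℕ}

theorem traj_low_high (hd : 0 < d) (hdn : 2 * d ≤ n) (hl₁ : n - d < l₁) (hl₂ : n - d < l₂)
    (ha : a < d) (hdb : d ≤ b) (hb : b < n) (t : ℕ) :
    traj n d l₁ l₂ ((a : ZMod n), (b : ZMod n)) t =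
      (((min (a + t) (d - 1) : ℕ) : ZMod n), ((min (b + t) (n - 1) : ℕ) : ZMod n)) := by
  induction t with
  | zero =>
    rw [show min (a + 0) (d - 1) = a by omega, show min (b + 0) (n - 1) = b by omega]
    rfl
  | succ t ih =>
    rw [traj_succ, ih]
    exact Prod.ext
      (ite_natCast_min_succ
        (moves1_low_high_iff hd hdn hl₂ (by omega) (by omega) (by omega)))
      (ite_natCast_min_succ
        (moves2_low_high_iff hd hdn hl₁ (by omega) (by omega) (by omega)))

theorem traj_high_low (hd : 0 < d) (hdn : 2 * d ≤ n) (hl₁ : n - d < l₁) (hl₂ : n - d < l₂)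
    (ha : a < d) (hdb : d ≤ b) (hb : b < n) (t : ℕ) :
    traj n d l₁ l₂ ((b : ZMod n), (a : ZMod n)) t =
      (((min (b + t) (n - 1) : ℕ) : ZMod n), ((min (a + t) (d - 1) : ℕ) : ZMod n)) := by
  induction t with
  | zero =>
    rw [show min (a + 0) (d - 1) = a by omega, show min (b + 0) (n - 1) = b by omega]
    rfl
  | succ t ih =>
    rw [traj_succ, ih]
    exact Prod.ext
      (ite_natCast_min_succ
        (moves1_high_low_iff hd hdn hl₂ (by omega) (by omega) (by omega)))
      (ite_natCast_min_succ
        (moves2_high_low_iff hd hdn hl₁ (by omega) (by omega) (by omega)))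

theorem collapseFrom_low_high (hd : 0 < d) (hdn : 2 * d ≤ n) (hl₁ : n - d < l₁)
    (hl₂ : n - d < l₂) (ha : a < d) (hdb : d ≤ b) (hb : b < n) :
    CollapseFrom n d l₁ l₂ ((a : ZMod n), (b : ZMod n)) n := by
  intro t ht
  rw [traj_low_high hd hdn hl₁ hl₂ ha hdb hb,
    moves1_low_high_iff hd hdn hl₂ (by omega) (by omega) (by omega),
    moves2_low_high_iff hd hdn hl₁ (by omega) (by omega) (by omega)]
  omega

theorem collapseFrom_high_low (hd : 0 < d) (hdn : 2 * d ≤ n) (hl₁ : n - d < l₁)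
    (hl₂ : n - d < l₂) (ha : a < d) (hdb : d ≤ b) (hb : b < n) :
    CollapseFrom n d l₁ l₂ ((b : ZMod n), (a : ZMod n)) n := by
  intro t ht
  rw [traj_high_low hd hdn hl₁ hl₂ ha hdb hb,
    moves1_high_low_iff hd hdn hl₂ (by omega) (by omega) (by omega),
    moves2_high_low_iff hd hdn hl₁ (by omega) (by omega) (by omega)]
  omega

end LongClusters

/-- Theorem 3 (sufficiency): if `l₁ > n - d`, the system results in a state of
collapse from any admissible initial state. -/
theorem theorem3_collapse (n d l₁ l₂ : ℕ)
    (hd : 0 < d) (hdn : 2 * d ≤ n) (hl₁ : 0 < l₁) (hl₁₂ : l₁ ≤ l₂) (hl₂ : l₂ < n)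
    (h : n - d < l₁) :
    ∀ x0 : TCState n, Admissible n d l₁ l₂ x0 →
      ∃ t₀ : ℕ, CollapseFrom n d l₁ l₂ x0 t₀ := by
  rintro ⟨x, y⟩ ⟨h1, h2⟩
  have hl : n - d < l₂ := by omega
  have : NeZero n := ⟨by omega⟩
  obtain ⟨a, ha, rfl⟩ : ∃ a : ℕ, a < n ∧ (a : ZMod n) = x :=
    ⟨x.val, x.val_lt, ZMod.natCast_zmod_val x⟩
  obtain ⟨b, hb, rfl⟩ : ∃ b : ℕ, b < n ∧ (b : ZMod n) = y :=
    ⟨y.val, y.val_lt, ZMod.natCast_zmod_val y⟩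
  refine ⟨n, ?_⟩
  rcases lt_or_ge a d with had | had <;> rcases lt_or_ge b d with hbd | hbd
  · exact absurd ⟨occupiesNode1_natCast hdn h had, occupiesNode1_natCast hdn hl hbd⟩ h1
  · exact collapseFrom_low_high hd hdn h hl had hbd hb
  · exact collapseFrom_high_low hd hdn h hl hbd had ha
  · exact absurd ⟨occupiesNode2_natCast h had ha, occupiesNode2_natCast hl hbd hb⟩ h2
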